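/- arXiv:1702.04971 — 2 statements merged into one kernel-verified Lean document; each statement's English description precedes it below -/
import Mathlib

section
/- There exist τ₀ > 0 and C > 0 depending only on T − t₀, c₀, H₀, C_g := C_c² and C₁,…,C₆ (independent of ω̃, τ, n, d) such that: if the filter functions ψ_E, φ_E satisfy filter conditions (i)–(vi), the initial data satisfy the Initial-data bounds, and the step size satisfies 0 < τ ≤ τ₀ and τ·ω̃ ≥ c₀, then the magnetic-flux iterates b_n of the triple splitting scheme and the exact solution b of the semidiscrete Maxwell system satisfy ‖b_n − b(t_n)‖ ≤ C·τ² for all n with t_n := t₀ + n·τ ≤ T. -/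
noncomputable def sinc (z : ℝ) : ℝ := if z = 0 then 1 else Real.sin z / z

noncomputable def mulE {d : ℕ} (A : Matrix (Fin d) (Fin d) ℝ)
    (v : EuclideanSpace ℝ (Fin d)) : EuclideanSpace ℝ (Fin d) :=
  (WithLp.equiv 2 (Fin d → ℝ)).symm (A.mulVec ((WithLp.equiv 2 (Fin d → ℝ)) v))

noncomputable def fDiag {d : ℕ} (f : ℝ → ℝ) (s : ℝ) (ωv : Fin d → ℝ) :
    Matrix (Fin d) (Fin d) ℝ :=
  Matrix.diagonal fun i => f (s * ωv i)

/-- One step of the triple splitting scheme (with `ψ_B ≡ φ_B ≡ 1`),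
acting on a state `(p, e, b)`. -/
noncomputable def tripleSplitStep {d : ℕ} (CE CB : Matrix (Fin d) (Fin d) ℝ)
    (ψE φE : ℝ → ℝ) (τ : ℝ) (ωv : Fin d → ℝ)
    (s : EuclideanSpace ℝ (Fin d) × EuclideanSpace ℝ (Fin d) × EuclideanSpace ℝ (Fin d)) :
    EuclideanSpace ℝ (Fin d) × EuclideanSpace ℝ (Fin d) × EuclideanSpace ℝ (Fin d) :=
  let p := s.1
  let e := s.2.1
  let b := s.2.2
  let bh := b - (τ/2) • mulE CE (mulE (fDiag φE (τ/2) ωv) e)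
  let ep := e + (τ/2) • mulE (fDiag ψE (τ/2) ωv) (mulE CB bh)
  let p1 := mulE (fDiag Real.cos τ ωv) p + τ • mulE (fDiag sinc τ ωv) ep
  let em := -mulE (Matrix.diagonal fun i => ωv i * Real.sin (τ * ωv i)) p
              + mulE (fDiag Real.cos τ ωv) ep
  let e1 := em + (τ/2) • mulE (fDiag ψE (τ/2) ωv) (mulE CB bh)
  let b1 := bh - (τ/2) • mulE CE (mulE (fDiag φE (τ/2) ωv) e1)
  (p1, e1, b1)

/-- The exact flow, split into the components `u` of the field with zero frequency and the
components `w = q'` with frequency `ω`. -/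
structure IsExactFlow {E : Type*} [NormedAddCommGroup E] [InnerProductSpace ℝ E]
    (A BP BQ : E →L[ℝ] E) (ω : ℝ) (u b q w : ℝ → E) : Prop where
  u_deriv : ∀ t, HasDerivAt u (BP (b t)) t
  b_deriv : ∀ t, HasDerivAt b (-A (u t + w t)) t
  q_deriv : ∀ t, HasDerivAt q (w t) t
  w_deriv : ∀ t, HasDerivAt w (BQ (b t) - ω ^ 2 • q t) t

/-- The triple splitting scheme, split into the components of zero frequency and the components
of frequency `ω`; here `h` is the sequence of half-step values of `b`. -/
structure IsDiscreteFlow {E : Type*} [NormedAddCommGroup E] [InnerProductSpace ℝ E]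
    (A BP BQ : E →L[ℝ] E) (ω τ ψ φ : ℝ) (u b q w h : ℕ → E) : Prop where
  h_eq : ∀ n, h n = b n - (τ / 2) • A (u n + φ • w n)
  u_succ : ∀ n, u (n + 1) = u n + τ • BP (h n)
  q_succ : ∀ n, q (n + 1) = Real.cos (τ * ω) • q n
    + (Real.sin (τ * ω) / ω) • (w n + (τ / 2 * ψ) • BQ (h n))
  w_succ : ∀ n, w (n + 1) = -(ω * Real.sin (τ * ω)) • q n
    + Real.cos (τ * ω) • (w n + (τ / 2 * ψ) • BQ (h n)) + (τ / 2 * ψ) • BQ (h n)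
  b_succ : ∀ n, b (n + 1) = h n - (τ / 2) • A (u (n + 1) + φ • w (n + 1))

theorem abs_sinc_le_one (z : ℝ) : |sinc z| ≤ 1 := by
  unfold sinc
  split_ifs with h
  · simp
  · rw [abs_div, div_le_one (abs_pos.mpr h)]
    exact Real.abs_sin_le_abs

theorem le_exp_mul_of_succ_le {a : ℕ → ℝ} {ε δ : ℝ} (hε : 0 ≤ ε) (hδ : 0 ≤ δ) (n : ℕ)
    (ha : 0 ≤ a 0) (h : ∀ m < n, a (m + 1) ≤ (1 + ε) * a m + δ) :
    a n ≤ Real.exp (n * ε) * (a 0 + n * δ) := by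
  induction n with
  | zero => simp
  | succ n ih =>
    have ih' := ih fun m hm => h m (hm.trans n.lt_succ_self)
    have h1 : 1 + ε ≤ Real.exp ε := by linarith [Real.add_one_le_exp ε]
    have h2 : (1 : ℝ) ≤ Real.exp ((n + 1 : ℕ) * ε) := Real.one_le_exp (by positivity)
    have h3 : Real.exp ((n + 1 : ℕ) * ε) = Real.exp ε * Real.exp (n * ε) := by
      rw [← Real.exp_add]; push_cast; ring_nf
    calc a (n + 1) ≤ (1 + ε) * a n + δ := h n n.lt_succ_self
      _ ≤ (1 + ε) * (Real.exp (n * ε) * (a 0 + n * δ)) + δ := by gcongr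
      _ ≤ Real.exp ε * (Real.exp (n * ε) * (a 0 + n * δ)) + Real.exp ((n + 1 : ℕ) * ε) * δ := by
          gcongr
          nlinarith
      _ = _ := by rw [h3]; push_cast; ring

/-- The mean value inequality for a function compared with a quadratic polynomial. -/
theorem norm_sub_quadratic_le {E : Type*} [NormedAddCommGroup E] [NormedSpace ℝ E]
    {f f' : ℝ → E} {a τ M : ℝ} (v w : E)
    (hf : ∀ t, HasDerivAt f (f' t) t)
    (hM : ∀ s ∈ Set.Icc a (a + τ), ‖f' s - (v + (s - a) • w)‖ ≤ M)
    {s : ℝ} (hs : s ∈ Set.Icc a (a + τ)) :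
    ‖f s - (f a + (s - a) • v + ((s - a) ^ 2 / 2) • w)‖ ≤ M * τ := by
  have hd : ∀ t, HasDerivAt (fun t => f t - ((t - a) • v + ((t - a) ^ 2 / 2) • w))
      (f' t - (v + (t - a) • w)) t := by
    intro t
    have h1 : HasDerivAt (fun t : ℝ => t - a) 1 t := (hasDerivAt_id t).sub_const a
    have h2 : HasDerivAt (fun t : ℝ => (t - a) ^ 2 / 2) (t - a) t := by
      have := (h1.pow 2).div_const 2
      simpa using this
    simpa using (hf t).fun_sub ((h1.smul_const v).fun_add (h2.smul_const w))
  have hM0 : 0 ≤ M := (norm_nonneg _).trans (hM s hs)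
  have key := norm_image_sub_le_of_norm_deriv_le_segment' (a := a) (b := a + τ) (C := M)
    (fun x _ => (hd x).hasDerivWithinAt) (fun x hx => hM x ⟨hx.1, hx.2.le⟩) s hs
  have e : f s - (f a + (s - a) • v + ((s - a) ^ 2 / 2) • w)
      = f s - ((s - a) • v + ((s - a) ^ 2 / 2) • w)
        - (f a - ((a - a) • v + ((a - a) ^ 2 / 2) • w)) := by
    simp only [sub_self, zero_smul]
    simp
    abel
  rw [e]
  exact key.trans (by gcongr; linarith [hs.2])

theorem norm_rotation_sq {E : Type*} [NormedAddCommGroup E] [InnerProductSpace ℝ E]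
    (θ : ℝ) (x y : E) :
    ‖Real.cos θ • x + Real.sin θ • y‖ ^ 2 + ‖-Real.sin θ • x + Real.cos θ • y‖ ^ 2
      = ‖x‖ ^ 2 + ‖y‖ ^ 2 := by
  simp only [norm_add_sq_real, norm_smul, mul_pow, inner_smul_left, inner_smul_right,
    Real.norm_eq_abs, sq_abs, neg_smul, norm_neg, inner_neg_left, conj_trivial]
  linear_combination (‖x‖ ^ 2 + ‖y‖ ^ 2) * Real.sin_sq_add_cos_sq θ

theorem sqrt_norm_add_sq_le {E : Type*} [NormedAddCommGroup E] (x δ y : E) :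
    √(‖x + δ‖ ^ 2 + ‖y‖ ^ 2) ≤ √(‖x‖ ^ 2 + ‖y‖ ^ 2) + ‖δ‖ := by
  have hx : ‖x‖ ≤ √(‖x‖ ^ 2 + ‖y‖ ^ 2) := Real.le_sqrt_of_sq_le (by nlinarith [sq_nonneg ‖y‖])
  have hs := Real.sq_sqrt (show 0 ≤ ‖x‖ ^ 2 + ‖y‖ ^ 2 by positivity)
  refine Real.sqrt_le_iff.mpr ⟨by positivity, ?_⟩
  have h1 := pow_le_pow_left₀ (norm_nonneg _) (norm_add_le x δ) 2
  nlinarith [mul_le_mul_of_nonneg_right hx (norm_nonneg δ)]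

/-- The filter `φ` turns the sum of consecutive field values into a difference of fluxes. -/
theorem exists_filter_multiplier {ω τ φ c : ℝ} (hω : 0 < ω) (hτ : 0 < τ)
    (hc : 0 ≤ c) (h : |φ| ≤ c * |sinc (τ * ω / 2)|) :
    ∃ κ, |κ| ≤ c ∧ τ / 2 * φ * (1 + Real.cos (τ * ω)) = κ * (Real.sin (τ * ω) / ω) ∧
      τ / 2 * φ * (ω * Real.sin (τ * ω)) = κ * (1 - Real.cos (τ * ω)) := by
  have hx0 : 0 < τ * ω / 2 := by positivity
  rw [show τ * ω = 2 * (τ * ω / 2) by ring, Real.cos_two_mul, Real.sin_two_mul]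
  have hωx : ω = 2 * (τ * ω / 2) / τ := by field_simp
  generalize τ * ω / 2 = x at *
  rw [sinc, if_neg hx0.ne'] at h
  have hsc := Real.sin_sq_add_cos_sq x
  by_cases hS : Real.sin x = 0
  · have : φ = 0 := by simpa [hS] using h
    exact ⟨0, by simp [this, hc]⟩
  · refine ⟨x * (Real.cos x / Real.sin x) * φ, ?_, ?_, ?_⟩
    · calc |x * (Real.cos x / Real.sin x) * φ|
          = |x * (Real.cos x / Real.sin x)| * |φ| := abs_mul _ _
        _ ≤ |x * (Real.cos x / Real.sin x)| * (c * |Real.sin x / x|) := by gcongr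
        _ = c * |Real.cos x| := by
          have := abs_pos.mpr hS
          have := abs_pos.mpr hx0.ne'
          simp only [abs_mul, abs_div]
          field_simp
        _ ≤ c := mul_le_of_le_one_right hc (Real.abs_cos_le_one x)
    · rw [hωx]; field_simp; ring
    · rw [hωx]; field_simp
      linear_combination (2 * φ * Real.cos x) * hsc

/-- The filter `ψ` makes the equilibrium of the forced rotation bounded. -/
theorem exists_equilibrium_multiplier {ω τ ψ c : ℝ} (hω : 0 < ω) (hτ : 0 < τ)
    (hc : 0 ≤ c) (h : |(Real.cos (τ * ω) + 1) * ψ| ≤ c * |sinc (τ * ω)|) :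
    ∃ s, |s| ≤ c ∧ s * (1 - Real.cos (τ * ω)) = ω * (τ / 2 * ψ) * Real.sin (τ * ω) ∧
      s * Real.sin (τ * ω) = ω * (τ / 2 * ψ) * (1 + Real.cos (τ * ω)) := by
  have hx0 : 0 < τ * ω / 2 := by positivity
  revert h
  rw [show τ * ω = 2 * (τ * ω / 2) by ring, sinc, if_neg (by positivity), Real.cos_two_mul,
    Real.sin_two_mul]
  intro h
  have hωx : ω = 2 * (τ * ω / 2) / τ := by field_simp
  generalize τ * ω / 2 = x at *
  have hsc := Real.sin_sq_add_cos_sq x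
  by_cases hS : Real.sin x = 0
  · have hC : Real.cos x ^ 2 = 1 := by simpa [hS] using hsc
    have : ψ = 0 := by
      have : 2 * |ψ| ≤ 0 := by simpa [hS, hC] using h
      exact abs_eq_zero.mp (by linarith [abs_nonneg ψ])
    exact ⟨0, by simp [this, hc]⟩
  by_cases hC : Real.cos x = 0
  · exact ⟨0, by simp [hC, hc]⟩
  refine ⟨x * ψ * (Real.cos x / Real.sin x), ?_, ?_, ?_⟩
  · have h1 := abs_pos.mpr hS
    have h2 := abs_pos.mpr hC
    have e1 : |(2 * Real.cos x ^ 2 - 1 + 1) * ψ| = 2 * |Real.cos x| * (|Real.cos x| * |ψ|) := by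
      rw [sub_add_cancel, abs_mul, abs_mul, abs_pow, abs_two]; ring
    have e2 : c * |2 * Real.sin x * Real.cos x / (2 * x)|
        = 2 * |Real.cos x| * (c * |Real.sin x| / (2 * x)) := by
      rw [abs_div, abs_mul, abs_mul, abs_mul, abs_two, abs_of_pos hx0]; ring
    rw [e1, e2] at h
    have h3 := le_of_mul_le_mul_left h (by positivity)
    rw [abs_mul, abs_mul, abs_div, abs_of_pos hx0, mul_div_assoc', div_le_iff₀ h1]
    rw [le_div_iff₀ (by positivity)] at h3
    nlinarith [mul_nonneg hc h1.le]
  · rw [hωx]; field_simp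
    linear_combination (-2 * ψ) * hsc
  · rw [hωx]; field_simp; ring

section Bounds

variable {E : Type*} [NormedAddCommGroup E] [InnerProductSpace ℝ E] {A BP BQ : E →L[ℝ] E}

theorem IsDiscreteFlow.rotation_succ {ω τ ψ φ s : ℝ} {u b q w h : ℕ → E}
    (H : IsDiscreteFlow A BP BQ ω τ ψ φ u b q w h) (hω : 0 < ω)
    (hs1 : s * (1 - Real.cos (τ * ω)) = ω * (τ / 2 * ψ) * Real.sin (τ * ω))
    (hs2 : s * Real.sin (τ * ω) = ω * (τ / 2 * ψ) * (1 + Real.cos (τ * ω))) (n : ℕ) :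
    ω ^ 2 • q (n + 1) - s • BQ (h (n + 1)) = Real.cos (τ * ω) • (ω ^ 2 • q n - s • BQ (h n))
      + Real.sin (τ * ω) • (ω • w n) + s • BQ (h n - h (n + 1)) ∧
    ω • w (n + 1) = -Real.sin (τ * ω) • (ω ^ 2 • q n - s • BQ (h n))
      + Real.cos (τ * ω) • (ω • w n) := by
  constructor
  · rw [H.q_succ, map_sub]
    generalize Real.cos (τ * ω) = C, Real.sin (τ * ω) = S at *
    match_scalars
    · ring
    · field_simp
    · field_simp
      linear_combination -2 * hs1
    · ring
  · rw [H.w_succ]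
    have h2 : Real.sin (τ * ω) * s = ω * (τ / 2 * ψ) + ω * Real.cos (τ * ω) * (τ / 2 * ψ) := by
      linear_combination hs2
    simp only [smul_add, smul_sub, smul_smul, neg_mul, h2]
    module

/-- The discrete energy grows by a factor `1 + O(τ)` in each step. -/
theorem IsDiscreteFlow.energy_succ_le {ω τ ψ φ s k c0 c2 c4 : ℝ} {u b q w h : ℕ → E}
    (H : IsDiscreteFlow A BP BQ ω τ ψ φ u b q w h) (hτ : 0 < τ) (hτ1 : τ ≤ 1) (hc0 : 0 < c0)
    (hω : c0 ≤ ω) (hk : 0 ≤ k) (hc2 : 0 ≤ c2) (hc4 : 0 ≤ c4)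
    (hA : ∀ v, ‖A v‖ ≤ k * ‖v‖) (hBP : ∀ v, ‖BP v‖ ≤ k * ‖v‖) (hBQ : ∀ v, ‖BQ v‖ ≤ k * ‖v‖)
    (hφ : |φ| ≤ c2) (hs : |s| ≤ c4)
    (hs1 : s * (1 - Real.cos (τ * ω)) = ω * (τ / 2 * ψ) * Real.sin (τ * ω))
    (hs2 : s * Real.sin (τ * ω) = ω * (τ / 2 * ψ) * (1 + Real.cos (τ * ω))) (n : ℕ) :
    ‖u (n + 1)‖ + ‖h (n + 1)‖ +
        √(‖ω ^ 2 • q (n + 1) - s • BQ (h (n + 1))‖ ^ 2 + ‖ω • w (n + 1)‖ ^ 2)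
      ≤ (1 + (k + (1 + c4 * k) * (k * (1 + k + c2 / c0))) * τ) *
        (‖u n‖ + ‖h n‖ + √(‖ω ^ 2 • q n - s • BQ (h n)‖ ^ 2 + ‖ω • w n‖ ^ 2)) := by
  have hω0 : 0 < ω := hc0.trans_le hω
  obtain ⟨hx, hy⟩ := H.rotation_succ hω0 hs1 hs2 n
  have hrot := norm_rotation_sq (τ * ω) (ω ^ 2 • q n - s • BQ (h n)) (ω • w n)
  have hR := sqrt_norm_add_sq_le (Real.cos (τ * ω) • (ω ^ 2 • q n - s • BQ (h n))
    + Real.sin (τ * ω) • (ω • w n)) (s • BQ (h n - h (n + 1))) (ω • w (n + 1))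
  rw [← hx] at hR
  rw [← hy] at hrot
  rw [hrot] at hR
  have hw : ‖ω • w (n + 1)‖ ≤ √(‖ω ^ 2 • q n - s • BQ (h n)‖ ^ 2 + ‖ω • w n‖ ^ 2) := by
    rw [← hrot]
    exact Real.le_sqrt_of_sq_le (by nlinarith [sq_nonneg ‖Real.cos (τ * ω) •
      (ω ^ 2 • q n - s • BQ (h n)) + Real.sin (τ * ω) • (ω • w n)‖])
  set R := √(‖ω ^ 2 • q n - s • BQ (h n)‖ ^ 2 + ‖ω • w n‖ ^ 2) with hRdef
  have hR0 : 0 ≤ R := Real.sqrt_nonneg _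
  set a := ‖u n‖ + ‖h n‖ + R with ha
  have ha0 : 0 ≤ a := by positivity
  have hhn : ‖h n‖ ≤ a := by linarith [norm_nonneg (u n)]
  have hu : ‖u (n + 1)‖ ≤ ‖u n‖ + τ * (k * a) := by
    rw [H.u_succ]
    refine (norm_add_le _ _).trans ?_
    rw [norm_smul, Real.norm_of_nonneg hτ.le]
    have := (hBP (h n)).trans (mul_le_mul_of_nonneg_left hhn hk)
    gcongr
  have hu' : ‖u (n + 1)‖ ≤ (1 + k) * a := by
    have h1 : τ * (k * a) ≤ 1 * (k * a) := by gcongr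
    linarith [norm_nonneg (h n)]
  have hφw : ‖φ • w (n + 1)‖ ≤ c2 / c0 * a := by
    rw [norm_smul, Real.norm_of_nonneg hω0.le] at hw
    rw [norm_smul, Real.norm_eq_abs]
    have h1 : c0 * ‖w (n + 1)‖ ≤ a := by
      have := mul_le_mul_of_nonneg_right hω (norm_nonneg (w (n + 1)))
      linarith [norm_nonneg (h n), norm_nonneg (u n)]
    calc |φ| * ‖w (n + 1)‖ ≤ c2 * (a / c0) := by
          gcongr
          rwa [le_div_iff₀' hc0]
      _ = c2 / c0 * a := by ring
  have hh : ‖h n - h (n + 1)‖ ≤ τ * (k * (1 + k + c2 / c0)) * a := by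
    have e : h n - h (n + 1) = τ • A (u (n + 1) + φ • w (n + 1)) := by
      rw [H.h_eq (n + 1), H.b_succ n]; module
    rw [e, norm_smul, Real.norm_of_nonneg hτ.le]
    have h1 : ‖u (n + 1) + φ • w (n + 1)‖ ≤ (1 + k + c2 / c0) * a :=
      (norm_add_le _ _).trans (by linarith)
    calc τ * ‖A (u (n + 1) + φ • w (n + 1))‖ ≤ τ * (k * ((1 + k + c2 / c0) * a)) := by
          gcongr; exact (hA _).trans (by gcongr)
      _ = _ := by ring
  have hh' : ‖h (n + 1)‖ ≤ ‖h n‖ + ‖h n - h (n + 1)‖ := by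
    have := norm_sub_le (h n) (h n - h (n + 1))
    rwa [sub_sub_cancel] at this
  have hs' : ‖s • BQ (h n - h (n + 1))‖ ≤ c4 * k * (τ * (k * (1 + k + c2 / c0)) * a) := by
    rw [norm_smul, Real.norm_eq_abs, mul_assoc c4]
    gcongr
    exact (hBQ _).trans (by gcongr)
  linear_combination hu + hh' + hh + hR + hs'

theorem IsDiscreteFlow.energy_zero_le {ω τ ψ φ s k c0 c2 c4 K0 : ℝ} {u b q w h : ℕ → E}
    (H : IsDiscreteFlow A BP BQ ω τ ψ φ u b q w h) (hτ : 0 < τ) (hτ1 : τ ≤ 1) (hc0 : 0 < c0)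
    (hω : c0 ≤ ω) (hk : 0 ≤ k) (hc2 : 0 ≤ c2) (hc4 : 0 ≤ c4)
    (hA : ∀ v, ‖A v‖ ≤ k * ‖v‖) (hBQ : ∀ v, ‖BQ v‖ ≤ k * ‖v‖)
    (hφ : |φ| ≤ c2) (hs : |s| ≤ c4)
    (hu : ‖u 0‖ ≤ K0) (hb : ‖b 0‖ ≤ K0) (hw : ‖ω • w 0‖ ≤ K0) (hq : ‖ω ^ 2 • q 0‖ ≤ K0) :
    ‖u 0‖ + ‖h 0‖ + √(‖ω ^ 2 • q 0 - s • BQ (h 0)‖ ^ 2 + ‖ω • w 0‖ ^ 2)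
      ≤ 3 * K0 + (1 + c4 * k) * (K0 + k * (K0 + c2 / c0 * K0)) := by
  have hω0 : 0 < ω := hc0.trans_le hω
  have hK0 : 0 ≤ K0 := (norm_nonneg _).trans hu
  set Kh := K0 + k * (K0 + c2 / c0 * K0) with hKh
  have hKh0 : 0 ≤ Kh := by positivity
  have hh0 : ‖h 0‖ ≤ Kh := by
    rw [H.h_eq]
    have hw0 : ‖w 0‖ ≤ K0 / c0 := by
      rw [norm_smul, Real.norm_of_nonneg hω0.le] at hw
      rw [le_div_iff₀' hc0]
      exact (mul_le_mul_of_nonneg_right hω (norm_nonneg _)).trans hw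
    have h1 : ‖u 0 + φ • w 0‖ ≤ K0 + c2 / c0 * K0 := by
      refine (norm_add_le _ _).trans (add_le_add hu ?_)
      rw [norm_smul, Real.norm_eq_abs]
      calc |φ| * ‖w 0‖ ≤ c2 * (K0 / c0) := by gcongr
        _ = _ := by ring
    refine (norm_sub_le _ _).trans (add_le_add hb ?_)
    rw [norm_smul, Real.norm_of_nonneg (by positivity)]
    calc τ / 2 * ‖A (u 0 + φ • w 0)‖ ≤ 1 * (k * (K0 + c2 / c0 * K0)) := by
          gcongr
          · linarith
          · exact (hA _).trans (by gcongr)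
      _ = _ := one_mul _
  have h1 : ‖s • BQ (h 0)‖ ≤ c4 * (k * Kh) := by
    rw [norm_smul, Real.norm_eq_abs]
    gcongr
    exact (hBQ _).trans (by gcongr)
  have h2 : √(‖ω ^ 2 • q 0 - s • BQ (h 0)‖ ^ 2 + ‖ω • w 0‖ ^ 2)
      ≤ ‖ω ^ 2 • q 0 - s • BQ (h 0)‖ + ‖ω • w 0‖ :=
    Real.sqrt_le_iff.mpr ⟨by positivity, by
      nlinarith [norm_nonneg (ω ^ 2 • q 0 - s • BQ (h 0)), norm_nonneg (ω • w 0)]⟩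
  linarith [norm_sub_le (ω ^ 2 • q 0) (s • BQ (h 0))]

theorem exists_discrete_bound {k c0 c2 c4 K0 D : ℝ} (hc0 : 0 < c0) (hk : 0 ≤ k) (hc2 : 0 ≤ c2)
    (hc4 : 0 ≤ c4) (hK0 : 0 ≤ K0) :
    ∃ K : ℝ, 0 ≤ K ∧ ∀ (E : Type) [NormedAddCommGroup E] [InnerProductSpace ℝ E]
      (A BP BQ : E →L[ℝ] E) (ω τ ψ φ s : ℝ) (u b q w h : ℕ → E),
      IsDiscreteFlow A BP BQ ω τ ψ φ u b q w h → 0 < τ → τ ≤ 1 → c0 ≤ ω →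
      (∀ v, ‖A v‖ ≤ k * ‖v‖) → (∀ v, ‖BP v‖ ≤ k * ‖v‖) → (∀ v, ‖BQ v‖ ≤ k * ‖v‖) →
      |φ| ≤ c2 → |s| ≤ c4 →
      s * (1 - Real.cos (τ * ω)) = ω * (τ / 2 * ψ) * Real.sin (τ * ω) →
      s * Real.sin (τ * ω) = ω * (τ / 2 * ψ) * (1 + Real.cos (τ * ω)) →
      ‖u 0‖ ≤ K0 → ‖b 0‖ ≤ K0 → ‖ω • w 0‖ ≤ K0 → ‖ω ^ 2 • q 0‖ ≤ K0 →
      ∀ n : ℕ, n * τ ≤ D → ‖ω ^ 2 • q n‖ ≤ K ∧ ‖ω • w n‖ ≤ K := by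
  obtain ⟨c, hc⟩ : ∃ c, c = k + (1 + c4 * k) * (k * (1 + k + c2 / c0)) := ⟨_, rfl⟩
  obtain ⟨K1, hK1⟩ : ∃ K1, K1 = 3 * K0 + (1 + c4 * k) * (K0 + k * (K0 + c2 / c0 * K0)) := ⟨_, rfl⟩
  have hc0' : 0 ≤ c := by rw [hc]; positivity
  have hK10 : 0 ≤ K1 := by rw [hK1]; positivity
  refine ⟨(1 + c4 * k) * (Real.exp (c * D) * K1), by positivity, ?_⟩
  intro E _ _ A BP BQ ω τ ψ φ s u b q w h H hτ hτ1 hω hA hBP hBQ hφ hs hs1 hs2 hu hb hw hq n hn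
  have hω0 : 0 < ω := hc0.trans_le hω
  have hstep := le_exp_mul_of_succ_le
    (a := fun n => ‖u n‖ + ‖h n‖ + √(‖ω ^ 2 • q n - s • BQ (h n)‖ ^ 2 + ‖ω • w n‖ ^ 2))
    (ε := c * τ) (δ := 0) (by positivity) le_rfl n (by positivity) (fun m _ => by
      have := H.energy_succ_le hτ hτ1 hc0 hω hk hc2 hc4 hA hBP hBQ hφ hs hs1 hs2 m
      rwa [← hc, ← add_zero (_ * _)] at this)
  have h0 := H.energy_zero_le hτ hτ1 hc0 hω hk hc2 hc4 hA hBQ hφ hs hu hb hw hq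
  rw [← hK1] at h0
  have hfin : ‖u n‖ + ‖h n‖ + √(‖ω ^ 2 • q n - s • BQ (h n)‖ ^ 2 + ‖ω • w n‖ ^ 2)
      ≤ Real.exp (c * D) * K1 := by
    refine hstep.trans ?_
    rw [mul_zero, add_zero]
    have : (n : ℝ) * (c * τ) ≤ c * D := by nlinarith
    gcongr
  set R := √(‖ω ^ 2 • q n - s • BQ (h n)‖ ^ 2 + ‖ω • w n‖ ^ 2) with hR
  have hx : ‖ω ^ 2 • q n - s • BQ (h n)‖ ≤ R :=
    Real.le_sqrt_of_sq_le (by nlinarith [sq_nonneg ‖ω • w n‖])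
  have hy : ‖ω • w n‖ ≤ R :=
    Real.le_sqrt_of_sq_le (by nlinarith [sq_nonneg ‖ω ^ 2 • q n - s • BQ (h n)‖])
  have hM : 0 ≤ Real.exp (c * D) * K1 := by positivity
  have hck : 0 ≤ c4 * k := by positivity
  constructor
  · have h1 : ‖s • BQ (h n)‖ ≤ c4 * k * (Real.exp (c * D) * K1) := by
      rw [norm_smul, Real.norm_eq_abs, mul_assoc c4]
      gcongr
      refine (hBQ _).trans ?_
      gcongr
      linarith [norm_nonneg (u n), norm_nonneg (ω • w n)]
    have h2 := norm_add_le (ω ^ 2 • q n - s • BQ (h n)) (s • BQ (h n))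
    rw [sub_add_cancel] at h2
    linarith [norm_nonneg (u n), norm_nonneg (h n)]
  · have := mul_nonneg hck hM
    linarith [norm_nonneg (u n), norm_nonneg (h n)]

/-- The energy of the exact flow grows at most exponentially, uniformly in the frequency. -/
theorem IsExactFlow.energy_le {ω k c0 t0 t : ℝ} {u b q w : ℝ → E}
    (H : IsExactFlow A BP BQ ω u b q w) (hc0 : 0 < c0) (hω : c0 ≤ ω) (hk : 0 ≤ k)
    (hA : ∀ v, ‖A v‖ ≤ k * ‖v‖) (hBP : ∀ v, ‖BP v‖ ≤ k * ‖v‖) (hBQ : ∀ v, ‖BQ v‖ ≤ k * ‖v‖)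
    (ht : t0 ≤ t) :
    ‖u t‖ ^ 2 + ‖b t‖ ^ 2 + ‖ω • w t‖ ^ 2 + ‖ω ^ 2 • q t - BQ (b t)‖ ^ 2
      ≤ Real.exp ((k + (k + k ^ 2) * (1 + 1 / c0)) * (t - t0)) *
        (‖u t0‖ ^ 2 + ‖b t0‖ ^ 2 + ‖ω • w t0‖ ^ 2 + ‖ω ^ 2 • q t0 - BQ (b t0)‖ ^ 2) := by
  have hω0 : 0 < ω := hc0.trans_le hω
  set c := k + (k + k ^ 2) * (1 + 1 / c0) with hc
  set N : ℝ → ℝ := fun t =>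
    ‖u t‖ ^ 2 + ‖b t‖ ^ 2 + ‖ω • w t‖ ^ 2 + ‖ω ^ 2 • q t - BQ (b t)‖ ^ 2 with hN
  have hNd : ∀ t, HasDerivAt N (2 * inner ℝ (u t) (BP (b t)) + 2 * inner ℝ (b t) (-A (u t + w t))
      + 2 * inner ℝ (ω • w t) (ω • (BQ (b t) - ω ^ 2 • q t))
      + 2 * inner ℝ (ω ^ 2 • q t - BQ (b t)) (ω ^ 2 • w t - BQ (-A (u t + w t)))) t := fun t =>
    (((H.u_deriv t).norm_sq.add (H.b_deriv t).norm_sq).add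
      ((H.w_deriv t).const_smul ω).norm_sq).add
      (((H.q_deriv t).const_smul (ω ^ 2)).sub
        (BQ.hasFDerivAt.comp_hasDerivAt t (H.b_deriv t))).norm_sq
  have hNle : ∀ t, 2 * inner ℝ (u t) (BP (b t)) + 2 * inner ℝ (b t) (-A (u t + w t))
      + 2 * inner ℝ (ω • w t) (ω • (BQ (b t) - ω ^ 2 • q t))
      + 2 * inner ℝ (ω ^ 2 • q t - BQ (b t)) (ω ^ 2 • w t - BQ (-A (u t + w t))) ≤ c * N t := by
    intro t
    set r := ω ^ 2 • q t - BQ (b t) with hr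
    have e1 : inner ℝ (ω • w t) (ω • (BQ (b t) - ω ^ 2 • q t)) = -inner ℝ r (ω ^ 2 • w t) := by
      rw [show BQ (b t) - ω ^ 2 • q t = -r by rw [hr]; abel, smul_neg, inner_neg_right,
        inner_smul_left, inner_smul_right, inner_smul_right, real_inner_comm]
      simp; ring
    have e2 : inner ℝ r (ω ^ 2 • w t - BQ (-A (u t + w t)))
        = inner ℝ r (ω ^ 2 • w t) + inner ℝ r (BQ (A (u t + w t))) := by
      rw [map_neg, sub_neg_eq_add, inner_add_right]
    have hw : ‖w t‖ ≤ 1 / c0 * ‖ω • w t‖ := by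
      rw [norm_smul, Real.norm_of_nonneg hω0.le, div_mul_eq_mul_div, one_mul, le_div_iff₀' hc0]
      gcongr
    have hAe : ‖A (u t + w t)‖ ≤ k * (‖u t‖ + 1 / c0 * ‖ω • w t‖) :=
      (hA _).trans (by gcongr; exact (norm_add_le _ _).trans (by gcongr))
    have i1 : inner ℝ (u t) (BP (b t)) ≤ ‖u t‖ * (k * ‖b t‖) :=
      (real_inner_le_norm _ _).trans (by gcongr; exact hBP _)
    have i2 : inner ℝ (b t) (-A (u t + w t)) ≤ ‖b t‖ * (k * (‖u t‖ + 1 / c0 * ‖ω • w t‖)) :=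
      (real_inner_le_norm _ _).trans (by rw [norm_neg]; gcongr)
    have i3 : inner ℝ r (BQ (A (u t + w t)))
        ≤ ‖r‖ * (k * (k * (‖u t‖ + 1 / c0 * ‖ω • w t‖))) :=
      (real_inner_le_norm _ _).trans (by gcongr; exact (hBQ _).trans (by gcongr))
    have hNt : N t = ‖u t‖ ^ 2 + ‖b t‖ ^ 2 + ‖ω • w t‖ ^ 2 + ‖r‖ ^ 2 := rfl
    rw [e1, e2, hNt]
    generalize ‖u t‖ = x1 at *
    generalize ‖b t‖ = x2 at *
    generalize ‖ω • w t‖ = x3 at *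
    generalize ‖r‖ = x4 at *
    have hc0i : 0 ≤ 1 / c0 := by positivity
    have j : ∀ a b c d κ : ℝ, 0 ≤ κ → 2 * a * b * κ ≤ κ * (a ^ 2 + b ^ 2 + (c ^ 2 + d ^ 2)) :=
      fun a b c d κ h => by
        nlinarith [mul_nonneg h (sq_nonneg (a - b)), mul_nonneg h (sq_nonneg c),
          mul_nonneg h (sq_nonneg d)]
    have j1 := j x1 x2 x3 x4 k hk
    have j2 := j x2 x1 x3 x4 k hk
    have j3 := j x2 x3 x1 x4 (k * (1 / c0)) (by positivity)
    have j4 := j x4 x1 x2 x3 (k ^ 2) (by positivity)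
    have j5 := j x4 x3 x1 x2 (k ^ 2 * (1 / c0)) (by positivity)
    rw [hc]
    linear_combination 2 * i1 + 2 * i2 + 2 * i3 + j1 + j2 + j3 + j4 + j5
  have hF : Antitone fun t => Real.exp (-c * (t - t0)) * N t := by
    have hd : ∀ t, HasDerivAt (fun t => Real.exp (-c * (t - t0)) * N t) _ t := fun t =>
      ((((hasDerivAt_id t).sub_const t0).const_mul (-c)).exp).mul (hNd t)
    refine antitone_of_deriv_nonpos (fun t => (hd t).differentiableAt) fun t => ?_
    rw [(hd t).deriv]
    have := mul_le_mul_of_nonneg_left (hNle t) (Real.exp_pos (-c * (t - t0))).le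
    simp only [id]
    linarith
  have hfin := hF ht
  simp only [sub_self, mul_zero, Real.exp_zero, one_mul] at hfin
  calc N t = Real.exp (c * (t - t0)) * (Real.exp (-c * (t - t0)) * N t) := by
        rw [← mul_assoc, ← Real.exp_add]; simp
    _ ≤ Real.exp (c * (t - t0)) * N t0 := by gcongr

end Bounds

section Error

variable {E : Type*} [NormedAddCommGroup E] [InnerProductSpace ℝ E] {A BP BQ : E →L[ℝ] E}

theorem exists_exact_bound {k c0 K0 D : ℝ} (hc0 : 0 < c0) (hk : 0 ≤ k) :
    ∃ K : ℝ, 0 ≤ K ∧ ∀ (E : Type) [NormedAddCommGroup E] [InnerProductSpace ℝ E]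
      (A BP BQ : E →L[ℝ] E) (ω t0 : ℝ) (u b q w : ℝ → E),
      IsExactFlow A BP BQ ω u b q w → c0 ≤ ω →
      (∀ v, ‖A v‖ ≤ k * ‖v‖) → (∀ v, ‖BP v‖ ≤ k * ‖v‖) → (∀ v, ‖BQ v‖ ≤ k * ‖v‖) →
      ‖u t0‖ ≤ K0 → ‖b t0‖ ≤ K0 → ‖ω • w t0‖ ≤ K0 → ‖ω ^ 2 • q t0‖ ≤ K0 →
      ∀ t, t0 ≤ t → t ≤ t0 + D →
        ‖u t‖ ≤ K ∧ ‖b t‖ ≤ K ∧ ‖ω • w t‖ ≤ K ∧ ‖ω ^ 2 • q t‖ ≤ K := by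
  obtain ⟨c, hc⟩ : ∃ c, c = k + (k + k ^ 2) * (1 + 1 / c0) := ⟨_, rfl⟩
  have hcnn : 0 ≤ c := by rw [hc]; positivity
  set R := √(Real.exp (c * D) * (3 * K0 ^ 2 + ((1 + k) * K0) ^ 2)) with hR
  have hR0 : 0 ≤ R := Real.sqrt_nonneg _
  refine ⟨(1 + k) * R, by positivity, ?_⟩
  intro E _ _ A BP BQ ω t0 u b q w H hω hA hBP hBQ hu hb hw hq t ht htD
  have hen := H.energy_le hc0 hω hk hA hBP hBQ ht
  rw [← hc] at hen
  have hr0 : ‖ω ^ 2 • q t0 - BQ (b t0)‖ ≤ (1 + k) * K0 := by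
    have := (hBQ (b t0)).trans (mul_le_mul_of_nonneg_left hb hk)
    linarith [norm_sub_le (ω ^ 2 • q t0) (BQ (b t0))]
  have hsum : ‖u t‖ ^ 2 + ‖b t‖ ^ 2 + ‖ω • w t‖ ^ 2 + ‖ω ^ 2 • q t - BQ (b t)‖ ^ 2
      ≤ Real.exp (c * D) * (3 * K0 ^ 2 + ((1 + k) * K0) ^ 2) := by
    refine hen.trans ?_
    have h1 : c * (t - t0) ≤ c * D := by gcongr; linarith
    have h2 : ‖u t0‖ ^ 2 + ‖b t0‖ ^ 2 + ‖ω • w t0‖ ^ 2 + ‖ω ^ 2 • q t0 - BQ (b t0)‖ ^ 2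
        ≤ 3 * K0 ^ 2 + ((1 + k) * K0) ^ 2 := by
      rw [show 3 * K0 ^ 2 = K0 ^ 2 + K0 ^ 2 + K0 ^ 2 by ring]
      gcongr
    gcongr
  have hu' : ‖u t‖ ≤ R := Real.le_sqrt_of_sq_le (le_trans (by nlinarith) hsum)
  have hb' : ‖b t‖ ≤ R := Real.le_sqrt_of_sq_le (le_trans (by nlinarith) hsum)
  have hw' : ‖ω • w t‖ ≤ R := Real.le_sqrt_of_sq_le (le_trans (by nlinarith) hsum)
  have hr' : ‖ω ^ 2 • q t - BQ (b t)‖ ≤ R := Real.le_sqrt_of_sq_le (le_trans (by nlinarith) hsum)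
  have hkR : 0 ≤ k * R := by positivity
  refine ⟨by linarith, by linarith, by linarith, ?_⟩
  have h1 := (hBQ (b t)).trans (mul_le_mul_of_nonneg_left hb' hk)
  have h2 := norm_add_le (ω ^ 2 • q t - BQ (b t)) (BQ (b t))
  rw [sub_add_cancel] at h2
  linarith

theorem IsExactFlow.hasDerivAt_add {ω : ℝ} {u b q w : ℝ → E}
    (H : IsExactFlow A BP BQ ω u b q w) (t : ℝ) :
    HasDerivAt (fun t => b t + A (q t)) (-A (u t)) t := by
  rw [show -A (u t) = -A (u t + w t) + A (w t) by rw [map_add]; abel]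
  exact (H.b_deriv t).fun_add (A.hasFDerivAt.comp_hasDerivAt t (H.q_deriv t))

/-- The exact flow satisfies the first half of a leapfrog step for the non-oscillatory components
up to a defect of third order. -/
theorem IsExactFlow.defect_u_le {ω k K t τ : ℝ} {u b q w : ℝ → E}
    (H : IsExactFlow A BP BQ ω u b q w) (hτ : 0 ≤ τ) (hk : 0 ≤ k)
    (hA : ∀ v, ‖A v‖ ≤ k * ‖v‖) (hBP : ∀ v, ‖BP v‖ ≤ k * ‖v‖)
    (hb : ∀ s ∈ Set.Icc t (t + τ), ‖b s‖ ≤ K)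
    (hq : ∀ s ∈ Set.Icc t (t + τ), ‖q s‖ ≤ K * τ ^ 2) :
    ‖u (t + τ) - u t - τ • BP (b t + A (q t) - (τ / 2) • A (u t))‖
      ≤ (k ^ 3 * K + k ^ 2 * K) * τ ^ 3 := by
  have h1 : ∀ s ∈ Set.Icc t (t + τ), ‖u s - u t‖ ≤ k * K * τ := fun s hs => by
    have := norm_sub_quadratic_le (M := k * K) 0 0 H.u_deriv (a := t) (τ := τ) (fun s hs => by
      simpa using (hBP _).trans (mul_le_mul_of_nonneg_left (hb s hs) hk)) hs
    simpa using this
  have h2 : ∀ s ∈ Set.Icc t (t + τ),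
      ‖b s + A (q s) - (b t + A (q t) + (s - t) • -A (u t))‖ ≤ k * (k * K * τ) * τ := fun s hs => by
    have := norm_sub_quadratic_le (M := k * (k * K * τ)) (-A (u t)) 0 H.hasDerivAt_add
      (a := t) (τ := τ) (fun s hs => by
        rw [smul_zero, add_zero, ← neg_sub', norm_neg, ← map_sub]
        exact (hA _).trans (mul_le_mul_of_nonneg_left (h1 s hs) hk)) hs
    simpa using this
  have h3 := norm_sub_quadratic_le (M := k * (k * (k * K * τ) * τ) + k * (k * (K * τ ^ 2)))
    (BP (b t + A (q t))) (-BP (A (u t))) H.u_deriv (a := t) (τ := τ) (fun s hs => by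
      have e : BP (b s) - (BP (b t + A (q t)) + (s - t) • -BP (A (u t)))
          = BP (b s + A (q s) - (b t + A (q t) + (s - t) • -A (u t))) - BP (A (q s)) := by
        simp only [map_add, map_sub, map_smul, map_neg]; abel
      rw [e]
      refine (norm_sub_le _ _).trans (add_le_add ?_ ?_)
      · exact (hBP _).trans (mul_le_mul_of_nonneg_left (h2 s hs) hk)
      · exact (hBP _).trans (mul_le_mul_of_nonneg_left
          ((hA _).trans (mul_le_mul_of_nonneg_left (hq s hs) hk)) hk))
    (Set.right_mem_Icc.mpr (le_add_of_nonneg_right hτ))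
  rw [add_sub_cancel_left] at h3
  convert h3 using 1
  · congr 1
    simp only [map_add, map_sub, map_smul]
    module
  · ring

/-- The exact flow satisfies the second half of a leapfrog step for the non-oscillatory components
up to a defect of third order. -/
theorem IsExactFlow.defect_b_le {ω k K t τ : ℝ} {u b q w : ℝ → E}
    (H : IsExactFlow A BP BQ ω u b q w) (hτ : 0 ≤ τ) (hk : 0 ≤ k)
    (hA : ∀ v, ‖A v‖ ≤ k * ‖v‖) (hBP : ∀ v, ‖BP v‖ ≤ k * ‖v‖)
    (hu : ∀ s ∈ Set.Icc t (t + τ), ‖u s‖ ≤ K)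
    (hw : ∀ s ∈ Set.Icc t (t + τ), ‖w s‖ ≤ K) :
    ‖b (t + τ) + A (q (t + τ)) - (b t + A (q t)) + (τ / 2) • A (u t + u (t + τ))‖
      ≤ 3 * k ^ 3 * K * τ ^ 3 := by
  have h1 : ∀ s ∈ Set.Icc t (t + τ), ‖b s - b t‖ ≤ k * (K + K) * τ := fun s hs => by
    have := norm_sub_quadratic_le (M := k * (K + K)) 0 0 H.b_deriv (a := t) (τ := τ)
      (fun s hs => by
        rw [smul_zero, add_zero, sub_zero, norm_neg]
        exact (hA _).trans (mul_le_mul_of_nonneg_left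
          ((norm_add_le _ _).trans (add_le_add (hu s hs) (hw s hs))) hk)) hs
    simpa using this
  have h2 : ∀ s ∈ Set.Icc t (t + τ),
      ‖u s - (u t + (s - t) • BP (b t))‖ ≤ k * (k * (K + K) * τ) * τ := fun s hs => by
    have := norm_sub_quadratic_le (M := k * (k * (K + K) * τ)) (BP (b t)) 0 H.u_deriv
      (a := t) (τ := τ) (fun s hs => by
        rw [smul_zero, add_zero, ← map_sub]
        exact (hBP _).trans (mul_le_mul_of_nonneg_left (h1 s hs) hk)) hs
    simpa using this
  have hmem : t + τ ∈ Set.Icc t (t + τ) := Set.right_mem_Icc.mpr (le_add_of_nonneg_right hτ)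
  have h3 := norm_sub_quadratic_le (M := k * (k * (k * (K + K) * τ) * τ))
    (-A (u t)) (-A (BP (b t))) H.hasDerivAt_add (a := t) (τ := τ) (fun s hs => by
      have e : -A (u s) - (-A (u t) + (s - t) • -A (BP (b t)))
          = -A (u s - (u t + (s - t) • BP (b t))) := by
        simp only [map_add, map_sub, map_smul, smul_neg]; abel
      rw [e, norm_neg]
      exact (hA _).trans (mul_le_mul_of_nonneg_left (h2 s hs) hk)) hmem
  have h4 : ‖(τ / 2) • A (u (t + τ) - (u t + (t + τ - t) • BP (b t)))‖
      ≤ τ / 2 * (k * (k * (k * (K + K) * τ) * τ)) := by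
    rw [norm_smul, Real.norm_of_nonneg (by positivity)]
    exact mul_le_mul_of_nonneg_left ((hA _).trans (mul_le_mul_of_nonneg_left (h2 _ hmem) hk))
      (by positivity)
  refine le_trans (le_of_eq ?_) ((norm_add_le_of_le h3 h4).trans (le_of_eq ?_))
  · congr 1
    simp only [add_sub_cancel_left, map_add, map_sub, map_smul]
    module
  · ring

/-- Error propagation of the leapfrog step with perturbations `δ`, `d₁`, `d₂`. -/
theorem leapfrog_error_le {k τ M₀ M₁ M₂ : ℝ} (hτ : 0 ≤ τ) (hτ1 : τ ≤ 1) (hk : 0 ≤ k)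
    (hA : ∀ v, ‖A v‖ ≤ k * ‖v‖) (hBP : ∀ v, ‖BP v‖ ≤ k * ‖v‖)
    {x x' y y' δ d₁ d₂ : E} (hδ : ‖δ‖ ≤ M₀ * τ ^ 2) (hd₁ : ‖d₁‖ ≤ M₁ * τ ^ 3)
    (hd₂ : ‖d₂‖ ≤ M₂ * τ ^ 3)
    (hx : x' = x + τ • BP (y - (τ / 2) • A x - A δ) - d₁)
    (hy : y' = y - (τ / 2) • A (x + x') - d₂) :
    ‖x'‖ + ‖y'‖ ≤ (1 + k * (3 + 2 * k + k ^ 2) * τ) * (‖x‖ + ‖y‖)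
      + ((1 + k) * (k ^ 2 * M₀ + M₁) + M₂) * τ ^ 3 := by
  have hAx : ‖(τ / 2) • A x‖ ≤ k * ‖x‖ := by
    rw [norm_smul, Real.norm_of_nonneg (by positivity)]
    have h := hA x
    nlinarith [norm_nonneg (A x)]
  have h1 : ‖τ • BP (y - (τ / 2) • A x - A δ)‖
      ≤ τ * (k * (‖y‖ + k * ‖x‖ + k * (M₀ * τ ^ 2))) := by
    rw [norm_smul, Real.norm_of_nonneg hτ]
    gcongr
    refine (hBP _).trans (mul_le_mul_of_nonneg_left ?_ hk)
    refine (norm_sub_le _ _).trans (add_le_add ?_ ((hA δ).trans (by gcongr)))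
    exact (norm_sub_le _ _).trans (by gcongr)
  have hx' : ‖x'‖ ≤ ‖x‖ + τ * (k * (‖y‖ + k * ‖x‖ + k * (M₀ * τ ^ 2))) + M₁ * τ ^ 3 := by
    rw [hx]
    exact (norm_sub_le _ _).trans (add_le_add ((norm_add_le _ _).trans (by gcongr)) hd₁)
  have h2 : ‖(τ / 2) • A (x + x')‖ ≤ τ / 2 * (k * (‖x‖ + ‖x'‖)) := by
    rw [norm_smul, Real.norm_of_nonneg (by positivity)]
    gcongr
    exact (hA _).trans (mul_le_mul_of_nonneg_left (norm_add_le _ _) hk)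
  have hy' : ‖y'‖ ≤ ‖y‖ + τ / 2 * (k * (‖x‖ + ‖x'‖)) + M₂ * τ ^ 3 := by
    rw [hy]
    exact (norm_sub_le _ _).trans (add_le_add ((norm_sub_le _ _).trans (by gcongr)) hd₂)
  have hM0 : 0 ≤ M₀ * τ ^ 2 := (norm_nonneg _).trans hδ
  have hM1 : 0 ≤ M₁ * τ ^ 3 := (norm_nonneg _).trans hd₁
  set a := ‖x‖ + ‖y‖ with ha
  have hxa : ‖x‖ ≤ a := by linarith [norm_nonneg y]
  have hya : ‖y‖ ≤ a := by linarith [norm_nonneg x]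
  have ha0 : 0 ≤ a := by positivity
  set D₁ := (k ^ 2 * M₀ + M₁) * τ ^ 3 with hD₁
  have hD0 : 0 ≤ D₁ := by
    have : D₁ = k ^ 2 * τ * (M₀ * τ ^ 2) + M₁ * τ ^ 3 := by rw [hD₁]; ring
    rw [this]; positivity
  have e1 : ‖x'‖ ≤ ‖x‖ + τ * (k * (a + k * a)) + D₁ := by
    have : τ * (k * (‖y‖ + k * ‖x‖)) ≤ τ * (k * (a + k * a)) := by gcongr
    linear_combination hx' + this
  have e2 : ‖x'‖ ≤ (1 + k + k ^ 2) * a + D₁ := by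
    have : τ * (k * (a + k * a)) ≤ 1 * (k * (a + k * a)) := by gcongr
    linear_combination e1 + this + hxa
  have e3 : τ / 2 * (k * (‖x‖ + ‖x'‖)) ≤ τ * (k * ((2 + k + k ^ 2) * a)) + k * D₁ := by
    have i1 : τ / 2 * (k * (‖x‖ + ‖x'‖)) ≤ τ / 2 * (k * (a + ((1 + k + k ^ 2) * a + D₁))) := by
      gcongr
    have i2 : 0 ≤ τ / 2 * (k * ((2 + k + k ^ 2) * a)) := by positivity
    have i3 : τ / 2 * (k * D₁) ≤ 1 * (k * D₁) := by gcongr; linarith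
    linear_combination i1 + i2 + i3
  linear_combination e1 + hy' + e3

end Error

/-- Uniform second order convergence of the splitting scheme in decoupled form. -/
theorem exists_convergence_constant {k c0 c2 c4 K0 D : ℝ} (hc0 : 0 < c0) (hk : 0 ≤ k)
    (hc2 : 0 ≤ c2) (hc4 : 0 ≤ c4) (hK0 : 0 ≤ K0) (hD : 0 ≤ D) :
    ∃ C : ℝ, 0 < C ∧ ∀ (E : Type) [NormedAddCommGroup E] [InnerProductSpace ℝ E]
      (A BP BQ : E →L[ℝ] E) (ω τ ψ φ s κ t0 : ℝ) (u b q w h : ℕ → E) (u' b' q' w' : ℝ → E),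
      IsDiscreteFlow A BP BQ ω τ ψ φ u b q w h → IsExactFlow A BP BQ ω u' b' q' w' →
      u' t0 = u 0 → b' t0 = b 0 → q' t0 = q 0 → w' t0 = w 0 →
      0 < τ → τ ≤ 1 → 0 < ω → c0 ≤ τ * ω →
      (∀ v, ‖A v‖ ≤ k * ‖v‖) → (∀ v, ‖BP v‖ ≤ k * ‖v‖) → (∀ v, ‖BQ v‖ ≤ k * ‖v‖) →
      |φ| ≤ c2 → |s| ≤ c4 → |κ| ≤ c2 →
      s * (1 - Real.cos (τ * ω)) = ω * (τ / 2 * ψ) * Real.sin (τ * ω) →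
      s * Real.sin (τ * ω) = ω * (τ / 2 * ψ) * (1 + Real.cos (τ * ω)) →
      τ / 2 * φ * (1 + Real.cos (τ * ω)) = κ * (Real.sin (τ * ω) / ω) →
      τ / 2 * φ * (ω * Real.sin (τ * ω)) = κ * (1 - Real.cos (τ * ω)) →
      ‖u 0‖ ≤ K0 → ‖b 0‖ ≤ K0 → ‖ω • w 0‖ ≤ K0 → ‖ω ^ 2 • q 0‖ ≤ K0 →
      ∀ n : ℕ, n * τ ≤ D → ‖b n - b' (t0 + n * τ)‖ ≤ C * τ ^ 2 := by
  obtain ⟨Kd, hKd, hdisc⟩ := exists_discrete_bound (D := D) hc0 hk hc2 hc4 hK0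
  obtain ⟨Kx, hKx, hexact⟩ := exists_exact_bound (K0 := K0) (D := D) hc0 hk
  obtain ⟨K, hK⟩ : ∃ K, K = (1 + 1 / c0 + 1 / c0 ^ 2) * (Kd + Kx) := ⟨_, rfl⟩
  have hKnn : 0 ≤ K := by rw [hK]; positivity
  obtain ⟨c, hc⟩ : ∃ c, c = k * (3 + 2 * k + k ^ 2) := ⟨_, rfl⟩
  have hc' : 0 ≤ c := by rw [hc]; positivity
  obtain ⟨M, hM⟩ : ∃ M, M = (1 + k) * (k ^ 2 * (2 * c2 * K) + (k ^ 3 * K + k ^ 2 * K))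
    + 3 * k ^ 3 * K := ⟨_, rfl⟩
  have hM' : 0 ≤ M := by rw [hM]; positivity
  refine ⟨1 + (Real.exp (c * D) * ((c2 + 1) * k * K + D * M) + (c2 + 1) * k * K),
    by positivity, ?_⟩
  intro E _ _ A BP BQ ω τ ψ φ s κ t0 u b q w h u' b' q' w' H H' eu eb eq ew hτ hτ1 hω hτω
    hA hBP hBQ hφ hs hκ hs1 hs2 hκ1 hκ2 hu0 hb0 hw0 hq0 n hn
  have hω' : c0 ≤ ω := hτω.trans (mul_le_of_le_one_left hω.le hτ1)
  have hωinv : 1 / ω ≤ τ / c0 := by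
    rw [div_le_div_iff₀ hω hc0]; linarith
  have of_w : ∀ {R : ℝ} {v : E}, 0 ≤ R → R ≤ Kd + Kx → ‖ω • v‖ ≤ R → ‖v‖ ≤ K * τ := by
    intro R v hR hRK hv
    rw [norm_smul, Real.norm_of_nonneg hω.le] at hv
    calc ‖v‖ = 1 / ω * (ω * ‖v‖) := by field_simp
      _ ≤ τ / c0 * (Kd + Kx) := by gcongr; exact hv.trans hRK
      _ = (1 / c0) * (Kd + Kx) * τ := by ring
      _ ≤ K * τ := by
        rw [hK]; gcongr
        have : 0 ≤ 1 / c0 ^ 2 := by positivity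
        linarith
  have of_q : ∀ {R : ℝ} {v : E}, 0 ≤ R → R ≤ Kd + Kx → ‖ω ^ 2 • v‖ ≤ R → ‖v‖ ≤ K * τ ^ 2 := by
    intro R v hR hRK hv
    rw [norm_smul, Real.norm_of_nonneg (by positivity)] at hv
    calc ‖v‖ = (1 / ω) ^ 2 * (ω ^ 2 * ‖v‖) := by field_simp
      _ ≤ (τ / c0) ^ 2 * (Kd + Kx) := by gcongr; exact hv.trans hRK
      _ = (1 / c0 ^ 2) * (Kd + Kx) * τ ^ 2 := by ring
      _ ≤ K * τ ^ 2 := by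
        rw [hK]; gcongr
        have : 0 ≤ 1 / c0 := by positivity
        linarith
  have hτn : ∀ m ≤ n, (m : ℝ) * τ ≤ D := fun m hm => le_trans (by gcongr) hn
  have hd : ∀ m ≤ n, ‖q m‖ ≤ K * τ ^ 2 ∧ ‖w m‖ ≤ K * τ := fun m hm => by
    obtain ⟨h1, h2⟩ := hdisc E A BP BQ ω τ ψ φ s u b q w h H hτ hτ1 hω' hA hBP hBQ hφ hs hs1 hs2
      hu0 hb0 hw0 hq0 m (hτn m hm)
    exact ⟨of_q hKd (by linarith) h1, of_w hKd (by linarith) h2⟩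
  have hx : ∀ t, t0 ≤ t → t ≤ t0 + D →
      ‖u' t‖ ≤ K ∧ ‖b' t‖ ≤ K ∧ ‖w' t‖ ≤ K ∧ ‖q' t‖ ≤ K * τ ^ 2 := fun t ht htD => by
    obtain ⟨h1, h2, h3, h4⟩ := hexact E A BP BQ ω t0 u' b' q' w' H' hω' hA hBP hBQ
      (by rwa [eu]) (by rwa [eb]) (by rwa [ew]) (by rwa [eq]) t ht htD
    have hKK : Kx ≤ K := by
      have i1 : 0 ≤ 1 / c0 := by positivity
      have i2 : 0 ≤ 1 / c0 ^ 2 := by positivity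
      have i3 : 1 * (Kd + Kx) ≤ K := by rw [hK]; gcongr; linarith
      linarith
    exact ⟨h1.trans hKK, h2.trans hKK,
      (of_w hKx (by linarith) h3).trans (mul_le_of_le_one_right hKnn hτ1),
      of_q hKx (by linarith) h4⟩
  have hκA : ∀ {v : E}, ‖v‖ ≤ K * τ ^ 2 → ‖κ • A v‖ ≤ c2 * (k * (K * τ ^ 2)) := fun hv => by
    rw [norm_smul, Real.norm_eq_abs]
    gcongr
    exact (hA _).trans (by gcongr)
  have hA' : ∀ {v : E}, ‖v‖ ≤ K * τ ^ 2 → ‖A v‖ ≤ k * (K * τ ^ 2) := fun hv =>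
    (hA _).trans (by gcongr)
  have hsum : ∀ m, (τ / 2 * φ) • (w m + w (m + 1)) = κ • (q (m + 1) - q m) := fun m => by
    rw [H.w_succ, H.q_succ]
    generalize (τ / 2 * ψ) • BQ (h m) = g
    generalize Real.cos (τ * ω) = C, Real.sin (τ * ω) = S at *
    have e1 : w m + (-(ω * S) • q m + C • (w m + g) + g) = (1 + C) • (w m + g) - (ω * S) • q m := by
      module
    have e2 : C • q m + (S / ω) • (w m + g) - q m = (S / ω) • (w m + g) - (1 - C) • q m := by
      module
    rw [e1, e2, smul_sub, smul_sub, smul_smul, smul_smul, smul_smul, smul_smul, hκ1, hκ2]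
  have hmain := le_exp_mul_of_succ_le
    (a := fun m => ‖u m - u' (t0 + m * τ)‖
      + ‖b m + κ • A (q m) - (b' (t0 + m * τ) + A (q' (t0 + m * τ)))‖)
    (ε := c * τ) (δ := M * τ ^ 3) (by positivity) (by positivity) n (by positivity)
    (fun m hm => by
      have hmD : (m : ℝ) * τ + τ ≤ D := by
        have := hτn (m + 1) hm
        push_cast at this
        linarith
      have ht : t0 + ((m + 1 : ℕ) : ℝ) * τ = t0 + m * τ + τ := by push_cast; ring
      have hmem : ∀ s ∈ Set.Icc (t0 + m * τ) (t0 + m * τ + τ), t0 ≤ s ∧ s ≤ t0 + D :=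
        fun s hs => ⟨le_trans (le_add_of_nonneg_right (by positivity)) hs.1, by linarith [hs.2]⟩
      have hmx := fun s hs => hx s (hmem s hs).1 (hmem s hs).2
      have d1 := H'.defect_u_le hτ.le hk hA hBP (fun s hs => (hmx s hs).2.1)
        (fun s hs => (hmx s hs).2.2.2)
      have d2 := H'.defect_b_le hτ.le hk hA hBP (fun s hs => (hmx s hs).1)
        (fun s hs => (hmx s hs).2.2.1)
      have hδ : ‖κ • q m + (τ / 2 * φ) • w m‖ ≤ 2 * c2 * K * τ ^ 2 := by
        obtain ⟨i1, i2⟩ := hd m hm.le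
        refine (norm_add_le _ _).trans ?_
        rw [norm_smul, norm_smul, norm_mul, Real.norm_of_nonneg (show 0 ≤ τ / 2 by positivity),
          Real.norm_eq_abs, Real.norm_eq_abs]
        have j1 : |κ| * ‖q m‖ ≤ c2 * (K * τ ^ 2) := by gcongr
        have j2 : τ / 2 * |φ| * ‖w m‖ ≤ τ / 2 * c2 * (K * τ) := by gcongr
        have j3 : 0 ≤ c2 * K * τ ^ 2 := by positivity
        linear_combination j1 + j2 + j3 / 2
      have hstep := leapfrog_error_le hτ.le hτ1 hk hA hBP hδ d1 d2
        (x := u m - u' (t0 + m * τ))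
        (x' := u (m + 1) - u' (t0 + m * τ + τ))
        (y := b m + κ • A (q m) - (b' (t0 + m * τ) + A (q' (t0 + m * τ))))
        (y' := b (m + 1) + κ • A (q (m + 1))
          - (b' (t0 + m * τ + τ) + A (q' (t0 + m * τ + τ))))
        (by
          rw [H.u_succ, H.h_eq]
          simp only [map_add, map_sub, map_smul]
          module)
        (by
          have e := congrArg A (hsum m)
          simp only [map_add, map_sub, map_smul] at e
          rw [H.b_succ, H.h_eq]
          simp only [map_add, map_sub, map_smul]
          linear_combination (norm := module) -e)
      rw [← hc, ← hM] at hstep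
      rw [ht]
      exact hstep)
  have hinit : ‖u 0 - u' (t0 + (0 : ℕ) * τ)‖
      + ‖b 0 + κ • A (q 0) - (b' (t0 + (0 : ℕ) * τ) + A (q' (t0 + (0 : ℕ) * τ)))‖
      ≤ (c2 + 1) * k * K * τ ^ 2 := by
    have hq := (hd 0 n.zero_le).1
    simp only [Nat.cast_zero, zero_mul, add_zero, eu, eb, eq, sub_self, norm_zero, zero_add,
      add_sub_add_left_eq_sub]
    linear_combination norm_sub_le (κ • A (q 0)) (A (q 0)) + hκA hq + hA' hq
  have hfin : Real.exp (n * (c * τ)) * ((c2 + 1) * k * K * τ ^ 2 + n * (M * τ ^ 3))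
      ≤ Real.exp (c * D) * ((c2 + 1) * k * K * τ ^ 2 + D * (M * τ ^ 2)) := by
    have h1 : (n : ℝ) * (c * τ) ≤ c * D := by
      linear_combination c * hn
    have h2 : (n : ℝ) * (M * τ ^ 3) ≤ D * (M * τ ^ 2) := by
      linear_combination (M * τ ^ 2) * hn
    gcongr
  have hb : ‖b n + κ • A (q n) - (b' (t0 + n * τ) + A (q' (t0 + n * τ)))‖
      ≤ Real.exp (c * D) * ((c2 + 1) * k * K * τ ^ 2 + D * (M * τ ^ 2)) := by
    refine le_trans ?_ (hmain.trans (le_trans ?_ hfin))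
    · exact le_add_of_nonneg_left (norm_nonneg _)
    · gcongr
  have hqn := (hd n le_rfl).1
  have hqx := (hx (t0 + n * τ) (le_add_of_nonneg_right (by positivity)) (by linarith)).2.2.2
  have e : b n - b' (t0 + n * τ) = b n + κ • A (q n) - (b' (t0 + n * τ) + A (q' (t0 + n * τ)))
      - (κ • A (q n) - A (q' (t0 + n * τ))) := by abel
  rw [e]
  have hτ2 : 0 ≤ τ ^ 2 := by positivity
  linear_combination norm_sub_le (b n + κ • A (q n) - (b' (t0 + n * τ) + A (q' (t0 + n * τ))))
      (κ • A (q n) - A (q' (t0 + n * τ))) + hb + norm_sub_le (κ • A (q n)) (A (q' (t0 + n * τ)))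
      + hκA hqn + hA' hqx + hτ2

section Components

variable {d : ℕ}

@[simp]
theorem mulE_diagonal_apply (f : Fin d → ℝ) (v : EuclideanSpace ℝ (Fin d)) (i : Fin d) :
    mulE (Matrix.diagonal f) v i = f i * v i := by
  simp [mulE, Matrix.mulVec_diagonal]

theorem toEuclideanCLM_apply_eq_mulE (M : Matrix (Fin d) (Fin d) ℝ)
    (v : EuclideanSpace ℝ (Fin d)) : Matrix.toEuclideanCLM (𝕜 := ℝ) M v = mulE M v := rfl

/-- The projection onto the components of zero frequency. -/
noncomputable def zeroProj (ωv : Fin d → ℝ) :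
    EuclideanSpace ℝ (Fin d) →L[ℝ] EuclideanSpace ℝ (Fin d) :=
  Matrix.toEuclideanCLM (𝕜 := ℝ) (Matrix.diagonal fun i => if ωv i = 0 then 1 else 0)

/-- The projection onto the oscillatory components. -/
noncomputable def oscProj (ωv : Fin d → ℝ) :
    EuclideanSpace ℝ (Fin d) →L[ℝ] EuclideanSpace ℝ (Fin d) :=
  Matrix.toEuclideanCLM (𝕜 := ℝ) (Matrix.diagonal fun i => if ωv i = 0 then 0 else 1)

@[simp]
theorem zeroProj_apply (ωv : Fin d → ℝ) (v : EuclideanSpace ℝ (Fin d)) (i : Fin d) :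
    zeroProj ωv v i = if ωv i = 0 then v i else 0 := by
  rw [zeroProj, toEuclideanCLM_apply_eq_mulE, mulE_diagonal_apply]; simp

@[simp]
theorem oscProj_apply (ωv : Fin d → ℝ) (v : EuclideanSpace ℝ (Fin d)) (i : Fin d) :
    oscProj ωv v i = if ωv i = 0 then 0 else v i := by
  rw [oscProj, toEuclideanCLM_apply_eq_mulE, mulE_diagonal_apply]; simp

theorem norm_le_of_abs_apply_le {v w : EuclideanSpace ℝ (Fin d)} (h : ∀ i, |v i| ≤ |w i|) :
    ‖v‖ ≤ ‖w‖ := by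
  rw [EuclideanSpace.norm_eq, EuclideanSpace.norm_eq]
  gcongr with i
  exact h i

theorem norm_zeroProj_le (ωv : Fin d → ℝ) (v : EuclideanSpace ℝ (Fin d)) :
    ‖zeroProj ωv v‖ ≤ ‖v‖ :=
  norm_le_of_abs_apply_le fun i => by rw [zeroProj_apply]; split_ifs <;> simp

theorem norm_oscProj_le (ωv : Fin d → ℝ) (v : EuclideanSpace ℝ (Fin d)) :
    ‖oscProj ωv v‖ ≤ ‖v‖ :=
  norm_le_of_abs_apply_le fun i => by rw [oscProj_apply]; split_ifs <;> simp

variable {ωv : Fin d → ℝ} {ow : ℝ}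

theorem mulE_fDiag_eq {f : ℝ → ℝ} (hf : f 0 = 1) (s : ℝ) (hω : ∀ i, ωv i = 0 ∨ ωv i = ow)
    (how : 0 < ow) (v : EuclideanSpace ℝ (Fin d)) :
    mulE (fDiag f s ωv) v = zeroProj ωv v + f (s * ow) • oscProj ωv v := by
  ext i
  rcases hω i with h | h <;> simp [fDiag, h, hf, how.ne']

theorem mulE_diagonal_eq (hω : ∀ i, ωv i = 0 ∨ ωv i = ow) (v : EuclideanSpace ℝ (Fin d)) :
    mulE (Matrix.diagonal ωv) v = ow • oscProj ωv v := by
  ext i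
  rcases hω i with h | h <;> by_cases h0 : ow = 0 <;> simp [h, h0]

theorem mulE_diagonal_sq_eq (hω : ∀ i, ωv i = 0 ∨ ωv i = ow) (v : EuclideanSpace ℝ (Fin d)) :
    mulE (Matrix.diagonal ωv ^ 2) v = ow ^ 2 • oscProj ωv v := by
  ext i
  rw [Matrix.diagonal_pow, mulE_diagonal_apply]
  rcases hω i with h | h <;> by_cases h0 : ow = 0 <;> simp [h, h0]

theorem isExactFlow_of_hasDerivAt {CE CB : Matrix (Fin d) (Fin d) ℝ}
    (hω : ∀ i, ωv i = 0 ∨ ωv i = ow) {p e b : ℝ → EuclideanSpace ℝ (Fin d)}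
    (hp : ∀ t, HasDerivAt p (e t) t)
    (he : ∀ t, HasDerivAt e (mulE CB (b t) - mulE (Matrix.diagonal ωv ^ 2) (p t)) t)
    (hb : ∀ t, HasDerivAt b (-mulE CE (e t)) t) :
    IsExactFlow (Matrix.toEuclideanCLM (𝕜 := ℝ) CE)
      (zeroProj ωv ∘L Matrix.toEuclideanCLM (𝕜 := ℝ) CB)
      (oscProj ωv ∘L Matrix.toEuclideanCLM (𝕜 := ℝ) CB) ow
      (fun t => zeroProj ωv (e t)) b (fun t => oscProj ωv (p t)) (fun t => oscProj ωv (e t)) where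
  u_deriv t := by
    refine ((zeroProj ωv).hasFDerivAt.comp_hasDerivAt t (he t)).congr_deriv ?_
    rw [mulE_diagonal_sq_eq hω]
    ext i
    by_cases h : ωv i = 0 <;> simp [h, toEuclideanCLM_apply_eq_mulE]
  b_deriv t := by
    refine (hb t).congr_deriv ?_
    rw [toEuclideanCLM_apply_eq_mulE]
    congr 2
    ext i
    by_cases h : ωv i = 0 <;> simp [h]
  q_deriv t := (oscProj ωv).hasFDerivAt.comp_hasDerivAt t (hp t)
  w_deriv t := by
    refine ((oscProj ωv).hasFDerivAt.comp_hasDerivAt t (he t)).congr_deriv ?_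
    rw [mulE_diagonal_sq_eq hω]
    ext i
    by_cases h : ωv i = 0 <;> simp [h, toEuclideanCLM_apply_eq_mulE]

theorem isDiscreteFlow_tripleSplitStep {CE CB : Matrix (Fin d) (Fin d) ℝ} {ψE φE : ℝ → ℝ} {τ : ℝ}
    (hω : ∀ i, ωv i = 0 ∨ ωv i = ow) (how : 0 < ow) (hτ : 0 < τ) (hψ : ψE 0 = 1) (hφ : φE 0 = 1)
    {s : ℕ → EuclideanSpace ℝ (Fin d) × EuclideanSpace ℝ (Fin d) × EuclideanSpace ℝ (Fin d)}
    (hs : ∀ n, s (n + 1) = tripleSplitStep CE CB ψE φE τ ωv (s n)) :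
    IsDiscreteFlow (Matrix.toEuclideanCLM (𝕜 := ℝ) CE)
      (zeroProj ωv ∘L Matrix.toEuclideanCLM (𝕜 := ℝ) CB)
      (oscProj ωv ∘L Matrix.toEuclideanCLM (𝕜 := ℝ) CB) ow τ (ψE (τ / 2 * ow)) (φE (τ / 2 * ow))
      (fun n => zeroProj ωv (s n).2.1) (fun n => (s n).2.2) (fun n => oscProj ωv (s n).1)
      (fun n => oscProj ωv (s n).2.1)
      (fun n => (s n).2.2 - (τ / 2) • mulE CE (mulE (fDiag φE (τ / 2) ωv) (s n).2.1)) where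
  h_eq n := by
    rw [mulE_fDiag_eq hφ _ hω how, toEuclideanCLM_apply_eq_mulE]
  u_succ n := by
    rw [hs]
    simp only [tripleSplitStep, ContinuousLinearMap.comp_apply, toEuclideanCLM_apply_eq_mulE]
    generalize mulE CB _ = g
    ext i
    by_cases h : ωv i = 0
    · simp [h, fDiag, hψ]; ring
    · simp [h]
  q_succ n := by
    rw [hs]
    simp only [tripleSplitStep, ContinuousLinearMap.comp_apply, toEuclideanCLM_apply_eq_mulE]
    generalize mulE CB _ = g
    ext i
    rcases hω i with h | h
    · simp [h]
    · have : τ * sinc (τ * ow) = Real.sin (τ * ow) / ow := by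
        rw [sinc, if_neg (by positivity)]; field_simp
      simp [h, how.ne', fDiag, ← this]; ring
  w_succ n := by
    rw [hs]
    simp only [tripleSplitStep, ContinuousLinearMap.comp_apply, toEuclideanCLM_apply_eq_mulE]
    generalize mulE CB _ = g
    ext i
    rcases hω i with h | h
    · simp [h]
    · simp [h, how.ne', fDiag]; ring
  b_succ n := by
    rw [← mulE_fDiag_eq hφ _ hω how, toEuclideanCLM_apply_eq_mulE, hs]
    rfl

theorem norm_comp_toEuclideanCLM_apply_le {M : Matrix (Fin d) (Fin d) ℝ} {k : ℝ}
    {P : EuclideanSpace ℝ (Fin d) →L[ℝ] EuclideanSpace ℝ (Fin d)} (hP : ∀ v, ‖P v‖ ≤ ‖v‖)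
    (hM : ∀ v : EuclideanSpace ℝ (Fin d), ‖mulE M v‖ ≤ k * ‖v‖) (v : EuclideanSpace ℝ (Fin d)) :
    ‖(P ∘L Matrix.toEuclideanCLM (𝕜 := ℝ) M) v‖ ≤ k * ‖v‖ := by
  rw [ContinuousLinearMap.comp_apply, toEuclideanCLM_apply_eq_mulE]
  exact (hP _).trans (hM v)

end Components

/-- Second order error bound for the magnetic flux: under filter
conditions (i)–(vi), the initial-data bounds and `0 < τ ≤ τ₀`, `τ·ω̃ ≥ c₀`, the
magnetic-flux iterates of the triple splitting scheme satisfy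
`‖b_n − b(t_n)‖ ≤ C·τ²` for all `n` with `t_n = t₀ + n·τ ≤ T`, with `τ₀, C`
independent of `ω̃`, `τ`, `n`, `d`. -/
theorem stmt4
    (t0 T c0 H0 Cc C1 C2 C3 C4 C5 C6 : ℝ)
    (hT : t0 < T) (hc0 : 0 < c0) (hH0 : 0 < H0) (hCc : 0 < Cc) :
    ∃ τ0 : ℝ, 0 < τ0 ∧ ∃ C : ℝ, 0 < C ∧
      ∀ (d : ℕ), 1 ≤ d →
      ∀ (CE CB : Matrix (Fin d) (Fin d) ℝ), CB = CE.transpose →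
      ∀ (ow : ℝ), 0 < ow →
      ∀ (ωv : Fin d → ℝ), (∀ i, ωv i = 0 ∨ ωv i = ow) →
      (∀ v : EuclideanSpace ℝ (Fin d), ‖mulE CE v‖ ≤ Cc * ‖v‖) →
      (∀ v : EuclideanSpace ℝ (Fin d), ‖mulE CB v‖ ≤ Cc * ‖v‖) →
      ∀ (ψE φE : ℝ → ℝ),
        (∀ z, ψE (-z) = ψE z) → (∀ z, φE (-z) = φE z) → ψE 0 = 1 → φE 0 = 1 →
        (∀ z : ℝ, |(Real.cos z + 1) * ψE (z/2)| ≤ C1 * (sinc (z/2))^2) →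
        (∀ z : ℝ, |φE (z/2)| ≤ C2 * |sinc (z/2)|) →
        (∀ z : ℝ, |(Real.cos z + 1) * ψE (z/2) * φE (z/2)| ≤ C3 * |sinc z|) →
        (∀ z : ℝ, |(Real.cos z + 1) * ψE (z/2)| ≤ C4 * |sinc z|) →
        (∀ z : ℝ, |sinc z - (1/2) * (Real.cos z + 1) * ψE (z/2)| ≤ C5 * z^2 * |sinc z|) →
        (∀ z : ℝ, |sinc z - φE (z/2)| ≤ C6 * |z * Real.sin (z/2)|) →
      ∀ (p0 e0 b0 : EuclideanSpace ℝ (Fin d)),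
        ‖mulE (Matrix.diagonal ωv) e0‖^2 ≤ (2/3) * H0 →
        ‖mulE CB b0‖^2 ≤ (1/3) * min 1 (4 / C4^2) * H0 →
        ‖mulE ((Matrix.diagonal ωv)^2) p0‖^2 ≤ (1/3) * H0 →
        ‖mulE CE e0‖^2 ≤ 2 * H0 →
        ‖e0‖^2 ≤ H0 →
        ‖b0‖^2 ≤ H0 →
        ‖mulE ((Matrix.diagonal ωv)^2) (mulE CB b0)‖^2 ≤ H0 →
      ∀ (p e b : ℝ → EuclideanSpace ℝ (Fin d)),
        (∀ t, HasDerivAt p (e t) t) →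
        (∀ t, HasDerivAt e (mulE CB (b t) - mulE ((Matrix.diagonal ωv)^2) (p t)) t) →
        (∀ t, HasDerivAt b (-mulE CE (e t)) t) →
        p t0 = p0 → e t0 = e0 → b t0 = b0 →
      ∀ (τ : ℝ), 0 < τ → τ ≤ τ0 → c0 ≤ τ * ow →
      ∀ n : ℕ, t0 + (n : ℝ) * τ ≤ T →
        ‖((tripleSplitStep CE CB ψE φE τ ωv)^[n] (p0, e0, b0)).2.2
            - b (t0 + (n : ℝ) * τ)‖ ≤ C * τ^2 := by
  obtain ⟨C, hC, hconv⟩ := exists_convergence_constant hc0 hCc.le (abs_nonneg C2) (abs_nonneg C4)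
    (Real.sqrt_nonneg H0) (sub_nonneg.mpr hT.le)
  refine ⟨1, one_pos, C, hC, ?_⟩
  intro d _ CE CB _ ow how ωv hω hCE hCB ψE φE _ _ hψ hφ _ hφ2 _ hψ4 _ _ p0 e0 b0 hwe0 _ hqp0 _
    he0 hb0 _ p e b hp he hb ep ee eb τ hτ hτ1 hτω n hn
  have hz : τ / 2 * ow = τ * ow / 2 := by ring
  have hφ2' : |φE (τ / 2 * ow)| ≤ |C2| * |sinc (τ * ow / 2)| := by
    rw [hz]
    exact (hφ2 (τ * ow)).trans (by gcongr; exact le_abs_self C2)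
  have hψ4' : |(Real.cos (τ * ow) + 1) * ψE (τ / 2 * ow)| ≤ |C4| * |sinc (τ * ow)| := by
    rw [hz]
    exact (hψ4 (τ * ow)).trans (by gcongr; exact le_abs_self C4)
  obtain ⟨κ, hκ, hκ1, hκ2⟩ := exists_filter_multiplier how hτ (abs_nonneg C2) hφ2'
  obtain ⟨s, hs, hs1, hs2⟩ := exists_equilibrium_multiplier how hτ (abs_nonneg C4) hψ4'
  have hφ1 : |φE (τ / 2 * ow)| ≤ |C2| :=
    hφ2'.trans (mul_le_of_le_one_right (abs_nonneg _) (abs_sinc_le_one _))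
  rw [mulE_diagonal_eq hω] at hwe0
  rw [mulE_diagonal_sq_eq hω] at hqp0
  have hu0' : ‖zeroProj ωv e0‖ ≤ √H0 := (norm_zeroProj_le _ _).trans (Real.le_sqrt_of_sq_le he0)
  have hb0' : ‖b0‖ ≤ √H0 := Real.le_sqrt_of_sq_le hb0
  have hw0' : ‖ow • oscProj ωv e0‖ ≤ √H0 := Real.le_sqrt_of_sq_le (hwe0.trans (by linarith))
  have hq0' : ‖ow ^ 2 • oscProj ωv p0‖ ≤ √H0 := Real.le_sqrt_of_sq_le (hqp0.trans (by linarith))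
  have hBP := norm_comp_toEuclideanCLM_apply_le (norm_zeroProj_le ωv) hCB
  have hBQ := norm_comp_toEuclideanCLM_apply_le (norm_oscProj_le ωv) hCB
  obtain ⟨x, hx0, hx, hxn⟩ : ∃ x : ℕ → _, x 0 = (p0, e0, b0) ∧
      (∀ m, x (m + 1) = tripleSplitStep CE CB ψE φE τ ωv (x m)) ∧
      (tripleSplitStep CE CB ψE φE τ ωv)^[n] (p0, e0, b0) = x n :=
    ⟨fun m => (tripleSplitStep CE CB ψE φE τ ωv)^[m] (p0, e0, b0), rfl,
      fun _ => Function.iterate_succ_apply' _ _ _, rfl⟩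
  rw [hxn]
  have hdisc := isDiscreteFlow_tripleSplitStep hω how hτ hψ hφ hx
  have hexact := isExactFlow_of_hasDerivAt hω hp he hb
  have key := hconv (EuclideanSpace ℝ (Fin d)) _ _ _ ow τ _ _ s κ t0 _ _ _ _ _ _ _ _ _ hdisc hexact
  rw [hx0, ep, ee, eb] at key
  exact key rfl rfl rfl rfl hτ hτ1 how hτω hCE hBP hBQ hφ1 hs hκ hs1 hs2 hκ1 hκ2
    hu0' hb0' hw0' hq0' n (by linarith)
end

section
/- The new filter choice ψ_E(z) = sinc(z)², φ_E(z) = sinc(z) satisfies filter condition (v) with constant C₅ = 1/6: for every real z, |sinc z − (1/2)·(cos z + 1)·sinc(z/2)²| ≤ (1/6)·z²·|sinc z|. -/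
theorem sinc_le_one (z : ℝ) : sinc z ≤ 1 := by
  unfold sinc
  split_ifs with hz
  · exact le_rfl
  · refine (le_abs_self _).trans ?_
    rw [abs_div]
    exact div_le_one_of_le₀ Real.abs_sin_le_abs (abs_nonneg z)

theorem one_sub_sinc_le (z : ℝ) : 1 - sinc z ≤ z ^ 2 / 6 := by
  unfold sinc
  split_ifs with hz
  · simp [hz]
  · have key {x : ℝ} (hx : 0 < x) : 1 - Real.sin x / x ≤ x ^ 2 / 6 := by
      have h : 1 - x ^ 2 / 6 ≤ Real.sin x / x := by
        rw [le_div_iff₀ hx]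
        linarith [Real.sin_ge_sub_cube hx.le]
      linarith
    rcases lt_or_gt_of_ne hz with h | h
    · simpa using key (neg_pos.2 h)
    · exact key h

theorem half_cos_add_one_mul_sinc_half_sq (z : ℝ) :
    (1 / 2) * (Real.cos z + 1) * sinc (z / 2) ^ 2 = sinc z ^ 2 := by
  by_cases hz : z = 0
  · norm_num [hz, sinc]
  · have hs : Real.sin z = 2 * Real.sin (z / 2) * Real.cos (z / 2) := by
      rw [← Real.sin_two_mul, mul_div_cancel₀ z two_ne_zero]
    have hc : Real.cos z = 2 * Real.cos (z / 2) ^ 2 - 1 := by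
      rw [← Real.cos_two_mul, mul_div_cancel₀ z two_ne_zero]
    have hz2 : z / 2 ≠ 0 := div_ne_zero hz two_ne_zero
    simp only [sinc, if_neg hz, if_neg hz2, hs, hc]
    field_simp
    ring

/-- the new filter choice `ψ_E(z) = sinc(z)²` satisfies filter
condition (v) with constant `C₅ = 1/6`:
`|sinc z − (1/2)·(cos z + 1)·sinc(z/2)²| ≤ (1/6)·z²·|sinc z|` for all real `z`. -/
theorem stmt14 (z : ℝ) :
    |sinc z - (1/2) * (Real.cos z + 1) * (sinc (z/2))^2| ≤ (1/6) * z^2 * |sinc z| := by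
  have h : sinc z - sinc z ^ 2 = (1 - sinc z) * sinc z := by ring
  rw [half_cos_add_one_mul_sinc_half_sq, h, abs_mul, abs_of_nonneg (sub_nonneg.2 (sinc_le_one z))]
  gcongr
  linarith [one_sub_sinc_le z]
end
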